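/- arXiv:2007.10803 — 2 statements merged into one kernel-verified Lean document; each statement's English description precedes it below -/
import Mathlib

section
/- Let μ > 0 and x, s ∈ ℝ be fixed. Then for every ρ₀ > 0 the functions ρ ↦ z(x,s;μ,ρ) and ρ ↦ y(x,s;μ,ρ) are differentiable at ρ₀; writing z = z(x,s;μ,ρ₀) and y = y(x,s;μ,ρ₀), the derivative of ρ ↦ z(x,s;μ,ρ) at ρ₀ equals (1/ρ₀)·(z/(z+y))·(x − z), the derivative of ρ ↦ y(x,s;μ,ρ) at ρ₀ equals −(1/ρ₀)·(y/(z+y))·(y + x), and the derivative of ρ ↦ (z(x,s;μ,ρ) − x)² at ρ₀ equals −(2/ρ₀)·(z/(z+y))·(z − x)². -/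
noncomputable def zfun (x s μ ρ : ℝ) : ℝ :=
  (1 / (2 * ρ)) * (Real.sqrt ((s - ρ * x) ^ 2 + 4 * ρ * μ) - (s - ρ * x))

noncomputable def yfun (x s μ ρ : ℝ) : ℝ :=
  (1 / (2 * ρ)) * (Real.sqrt ((s - ρ * x) ^ 2 + 4 * ρ * μ) + (s - ρ * x))

theorem sqrt_arg_pos {μ ρ : ℝ} (x s : ℝ) (hμ : 0 < μ) (hρ : 0 < ρ) :
    0 < (s - ρ * x) ^ 2 + 4 * ρ * μ := by
  positivity

theorem hasDerivAt_sub_mul_const (x s ρ : ℝ) : HasDerivAt (fun ρ => s - ρ * x) (-x) ρ := by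
  simpa using ((hasDerivAt_id ρ).mul_const x).const_sub s

theorem hasDerivAt_sqrt_arg {μ ρ : ℝ} (x s : ℝ) (hμ : 0 < μ) (hρ : 0 < ρ) :
    HasDerivAt (fun ρ => √((s - ρ * x) ^ 2 + 4 * ρ * μ))
      ((2 * μ - (s - ρ * x) * x) / √((s - ρ * x) ^ 2 + 4 * ρ * μ)) ρ := by
  have h := (((hasDerivAt_sub_mul_const x s ρ).fun_pow 2).fun_add
    (((hasDerivAt_id' ρ).const_mul 4).mul_const μ)).sqrt (sqrt_arg_pos x s hμ hρ).ne'
  have hR := Real.sqrt_pos.2 (sqrt_arg_pos x s hμ hρ)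
  refine h.congr_deriv ?_
  field_simp
  norm_num
  ring

theorem hasDerivAt_one_div_two_mul {ρ : ℝ} (hρ : 0 < ρ) :
    HasDerivAt (fun ρ : ℝ => 1 / (2 * ρ)) (-(1 / (2 * ρ ^ 2))) ρ := by
  have h := ((hasDerivAt_id' ρ).const_mul 2).fun_inv (by positivity)
  simp only [one_div]
  refine h.congr_deriv ?_
  field_simp

theorem zfun_add_yfun (x s μ ρ : ℝ) :
    zfun x s μ ρ + yfun x s μ ρ = √((s - ρ * x) ^ 2 + 4 * ρ * μ) / ρ := by
  unfold zfun yfun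
  ring

theorem hasDerivAt_zfun {μ ρ : ℝ} (x s : ℝ) (hμ : 0 < μ) (hρ : 0 < ρ) :
    HasDerivAt (fun ρ => zfun x s μ ρ)
      ((1 / ρ) * (zfun x s μ ρ / (zfun x s μ ρ + yfun x s μ ρ)) * (x - zfun x s μ ρ)) ρ := by
  have h := (hasDerivAt_one_div_two_mul hρ).fun_mul
    ((hasDerivAt_sqrt_arg x s hμ hρ).fun_sub (hasDerivAt_sub_mul_const x s ρ))
  have hR := Real.sqrt_pos.2 (sqrt_arg_pos x s hμ hρ)
  have hsq := Real.sq_sqrt (sqrt_arg_pos x s hμ hρ).le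
  rw [zfun_add_yfun]
  unfold zfun
  refine h.congr_deriv ?_
  generalize √((s - ρ * x) ^ 2 + 4 * ρ * μ) = R at hR hsq ⊢
  field_simp
  linear_combination -hsq

theorem hasDerivAt_yfun {μ ρ : ℝ} (x s : ℝ) (hμ : 0 < μ) (hρ : 0 < ρ) :
    HasDerivAt (fun ρ => yfun x s μ ρ)
      (-((1 / ρ) * (yfun x s μ ρ / (zfun x s μ ρ + yfun x s μ ρ)) * (yfun x s μ ρ + x))) ρ := by
  have h := (hasDerivAt_one_div_two_mul hρ).fun_mul
    ((hasDerivAt_sqrt_arg x s hμ hρ).fun_add (hasDerivAt_sub_mul_const x s ρ))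
  have hR := Real.sqrt_pos.2 (sqrt_arg_pos x s hμ hρ)
  have hsq := Real.sq_sqrt (sqrt_arg_pos x s hμ hρ).le
  rw [zfun_add_yfun]
  unfold yfun
  refine h.congr_deriv ?_
  generalize √((s - ρ * x) ^ 2 + 4 * ρ * μ) = R at hR hsq ⊢
  field_simp
  linear_combination -hsq

theorem stmt_7 (μ x s : ℝ) (hμ : 0 < μ) : ∀ ρ₀ : ℝ, 0 < ρ₀ →
    HasDerivAt (fun ρ => zfun x s μ ρ)
      ((1 / ρ₀) * (zfun x s μ ρ₀ / (zfun x s μ ρ₀ + yfun x s μ ρ₀)) * (x - zfun x s μ ρ₀)) ρ₀ ∧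
    HasDerivAt (fun ρ => yfun x s μ ρ)
      (-((1 / ρ₀) * (yfun x s μ ρ₀ / (zfun x s μ ρ₀ + yfun x s μ ρ₀)) *
        (yfun x s μ ρ₀ + x))) ρ₀ ∧
    HasDerivAt (fun ρ => (zfun x s μ ρ - x) ^ 2)
      (-((2 / ρ₀) * (zfun x s μ ρ₀ / (zfun x s μ ρ₀ + yfun x s μ ρ₀)) *
        (zfun x s μ ρ₀ - x) ^ 2)) ρ₀ := by
  intro ρ hρ
  have hz := hasDerivAt_zfun x s hμ hρ
  refine ⟨hz, hasDerivAt_yfun x s hμ hρ, ?_⟩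
  refine ((hz.sub_const x).fun_pow 2).congr_deriv ?_
  norm_num
  ring
end

section
/- Let μ > 0 and ρ > 0. Then for all x, s ∈ ℝ: (i) the derivative of the function x ↦ G(x,s;μ,ρ) (with s fixed) at x equals −ρ·y(x,s;μ,ρ); (ii) the derivative of the function s ↦ G(x,s;μ,ρ) (with x fixed) at s equals z(x,s;μ,ρ) − x. -/
noncomputable def Gfun (x s μ ρ : ℝ) : ℝ :=
  -μ * Real.log (zfun x s μ ρ) + s * (zfun x s μ ρ - x) + (ρ / 2) * (zfun x s μ ρ - x) ^ 2

lemma zfun_pos {μ ρ : ℝ} (hμ : 0 < μ) (hρ : 0 < ρ) (x s : ℝ) : 0 < zfun x s μ ρ := by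
  have h : s - ρ * x < Real.sqrt ((s - ρ * x) ^ 2 + 4 * ρ * μ) :=
    Real.lt_sqrt_of_sq_lt (lt_add_of_pos_right _ (by positivity))
  exact mul_pos (by positivity) (sub_pos.2 h)

/-- `z` is a stationary point of `z ↦ -μ log z + s (z - x) + (ρ / 2) (z - x) ^ 2`. -/
lemma zfun_stationary {μ ρ : ℝ} (hμ : 0 < μ) (hρ : 0 < ρ) (x s : ℝ) :
    -μ / zfun x s μ ρ + s + ρ * (zfun x s μ ρ - x) = 0 := by
  have hz := (zfun_pos hμ hρ x s).ne'
  have hsq := Real.sq_sqrt (by positivity : 0 ≤ (s - ρ * x) ^ 2 + 4 * ρ * μ)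
  have hroot : 2 * ρ * zfun x s μ ρ + (s - ρ * x) =
      Real.sqrt ((s - ρ * x) ^ 2 + 4 * ρ * μ) := by
    unfold zfun
    field_simp
    ring
  rw [← hroot] at hsq
  have hquad : ρ * zfun x s μ ρ ^ 2 + (s - ρ * x) * zfun x s μ ρ - μ = 0 := by
    refine (mul_eq_zero.1 (?_ : (4 * ρ) * _ = 0)).resolve_left (by positivity)
    linear_combination hsq
  field_simp
  linear_combination hquad

lemma mul_yfun {ρ : ℝ} (hρ : 0 < ρ) (x s μ : ℝ) :
    ρ * yfun x s μ ρ = s + ρ * (zfun x s μ ρ - x) := by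
  unfold yfun zfun
  field_simp
  ring

/-- Envelope formula: along a differentiable curve `(a t, b t)`, the derivative of `G` only sees
the explicit dependence on `x` and `s`. -/
lemma HasDerivAt.gfun {μ ρ : ℝ} (hμ : 0 < μ) (hρ : 0 < ρ) {a b : ℝ → ℝ} {a' b' t : ℝ}
    (ha : HasDerivAt a a' t) (hb : HasDerivAt b b' t) :
    HasDerivAt (fun τ => Gfun (a τ) (b τ) μ ρ)
      (b' * (zfun (a t) (b t) μ ρ - a t) - a' * (ρ * yfun (a t) (b t) μ ρ)) t := by
  have hw : HasDerivAt (fun τ => b τ - ρ * a τ) (b' - ρ * a') t := hb.sub (ha.const_mul ρ)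
  have hne : (b t - ρ * a t) ^ 2 + 4 * ρ * μ ≠ 0 := by positivity
  obtain ⟨z', hz⟩ : ∃ z', HasDerivAt (fun τ => zfun (a τ) (b τ) μ ρ) z' t :=
    ⟨_, ((((hw.fun_pow 2).add_const (4 * ρ * μ)).sqrt hne).sub hw).const_mul (1 / (2 * ρ))⟩
  have hG := (((hz.log (zfun_pos hμ hρ _ _).ne').const_mul (-μ)).add
    (hb.mul (hz.sub ha))).add (((hz.sub ha).fun_pow 2).const_mul (ρ / 2))
  refine hG.congr_deriv ?_
  rw [mul_yfun hρ]
  simp only [Pi.sub_apply]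
  linear_combination z' * zfun_stationary hμ hρ (a t) (b t)

theorem stmt_9 (μ ρ : ℝ) (hμ : 0 < μ) (hρ : 0 < ρ) : ∀ x s : ℝ,
    HasDerivAt (fun t => Gfun t s μ ρ) (-(ρ * yfun x s μ ρ)) x ∧
    HasDerivAt (fun t => Gfun x t μ ρ) (zfun x s μ ρ - x) s := by
  intro x s
  constructor
  · simpa using HasDerivAt.gfun hμ hρ (hasDerivAt_id x) (hasDerivAt_const x s)
  · simpa using HasDerivAt.gfun hμ hρ (hasDerivAt_const s x) (hasDerivAt_id s)
end
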